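/- For every t ∈ ℝ and every b ∈ ℝ, one has Γ₁(t)(b·i) ≠ 0 and Γ₁(t)(3 + b·i) ≠ 0; that is, the polynomials Γ₁(t) have no root on the lines Re(z) = 0 and Re(z) = 3. -/

import Mathlib

open Polynomial

/-- The quartic `Γ₁(t)(X) = X⁴ − (16/3)X³ + (13/2 − (1/2)e^{2πit})X²
+ (3e^{2πit} − 3)X − 1/3`. -/
noncomputable def Gamma1 (t : ℝ) : Polynomial ℂ :=
  X ^ 4 - C (16 / 3 : ℂ) * X ^ 3
    + C ((13 / 2 : ℂ) - (1 / 2 : ℂ) * Complex.exp (2 * Real.pi * Complex.I * t)) * X ^ 2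
    + C (3 * Complex.exp (2 * Real.pi * Complex.I * t) - 3) * X
    - C (1 / 3 : ℂ)

/-- A sum `p + u * q` with `u` on the unit circle vanishes only if `p` and `q` have equal norm. -/
theorem normSq_eq_of_add_unit_mul_eq_zero {p q u : ℂ} (hu : ‖u‖ = 1) (h : p + u * q = 0) :
    Complex.normSq p = Complex.normSq q := by
  rw [eq_neg_of_add_eq_zero_left h, Complex.normSq_neg, Complex.normSq_mul,
    Complex.normSq_eq_norm_sq u, hu, one_pow, one_mul]

theorem Gamma1_eval (t : ℝ) (z : ℂ) :
    (Gamma1 t).eval z = (z ^ 4 - 16 / 3 * z ^ 3 + 13 / 2 * z ^ 2 - 3 * z - 1 / 3)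
      + Complex.exp (2 * Real.pi * Complex.I * t) * (3 * z - z ^ 2 / 2) := by
  simp only [Gamma1, eval_add, eval_sub, eval_mul, eval_pow, eval_X, eval_C]
  ring

theorem normSq_eq_of_Gamma1_eval_eq_zero {t : ℝ} {z : ℂ} (h : (Gamma1 t).eval z = 0) :
    Complex.normSq (z ^ 4 - 16 / 3 * z ^ 3 + 13 / 2 * z ^ 2 - 3 * z - 1 / 3)
      = Complex.normSq (3 * z - z ^ 2 / 2) := by
  refine normSq_eq_of_add_unit_mul_eq_zero ?_ ((Gamma1_eval t z).symm.trans h)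
  have harg : (2 * Real.pi * Complex.I * t : ℂ) = ((2 * Real.pi * t : ℝ) : ℂ) * Complex.I := by
    push_cast
    ring
  rw [harg, Complex.norm_exp_ofReal_mul_I]

/-- for all real `t` and `b`, the polynomial `Γ₁(t)` does not
vanish at `b·i` nor at `3 + b·i`; i.e. `Γ₁(t)` has no root on the lines
`Re z = 0` and `Re z = 3`. -/
theorem stmt_16 (t b : ℝ) :
    (Gamma1 t).eval ((b : ℂ) * Complex.I) ≠ 0 ∧
      (Gamma1 t).eval (3 + (b : ℂ) * Complex.I) ≠ 0 := by
  have hI4 : Complex.I ^ 4 = 1 := Complex.I_pow_four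
  have hI3 : Complex.I ^ 3 = -Complex.I := Complex.I_pow_three
  constructor
  · intro h
    have key := normSq_eq_of_Gamma1_eval_eq_zero h
    have hp : ((b * Complex.I) ^ 4 - 16 / 3 * (b * Complex.I) ^ 3 + 13 / 2 * (b * Complex.I) ^ 2
        - 3 * (b * Complex.I) - 1 / 3 : ℂ)
        = ((b ^ 4 - 13 / 2 * b ^ 2 - 1 / 3 : ℝ) : ℂ)
          + ((16 / 3 * b ^ 3 - 3 * b : ℝ) : ℂ) * Complex.I := by
      push_cast
      linear_combination (b : ℂ) ^ 4 * hI4 - 16 / 3 * (b : ℂ) ^ 3 * hI3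
        + 13 / 2 * (b : ℂ) ^ 2 * Complex.I_sq
    have hq : (3 * (b * Complex.I) - (b * Complex.I) ^ 2 / 2 : ℂ)
        = ((b ^ 2 / 2 : ℝ) : ℂ) + ((3 * b : ℝ) : ℂ) * Complex.I := by
      push_cast
      linear_combination -(b : ℂ) ^ 2 / 2 * Complex.I_sq
    rw [hp, hq, Complex.normSq_add_mul_I, Complex.normSq_add_mul_I] at key
    have hpos : 0 < b ^ 8 + 139 / 9 * b ^ 6 + 28 / 3 * b ^ 4 + 13 / 3 * b ^ 2 + 1 / 9 := by
      positivity
    linarith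
  · intro h
    have key := normSq_eq_of_Gamma1_eval_eq_zero h
    have hp : ((3 + b * Complex.I) ^ 4 - 16 / 3 * (3 + b * Complex.I) ^ 3
        + 13 / 2 * (3 + b * Complex.I) ^ 2 - 3 * (3 + b * Complex.I) - 1 / 3 : ℂ)
        = ((b ^ 4 - 25 / 2 * b ^ 2 - 83 / 6 : ℝ) : ℂ)
          + ((-(20 / 3) * b ^ 3 : ℝ) : ℂ) * Complex.I := by
      push_cast
      linear_combination (b : ℂ) ^ 4 * hI4 + 20 / 3 * (b : ℂ) ^ 3 * hI3
        + 25 / 2 * (b : ℂ) ^ 2 * Complex.I_sq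
    have hq : (3 * (3 + b * Complex.I) - (3 + b * Complex.I) ^ 2 / 2 : ℂ)
        = (((9 + b ^ 2) / 2 : ℝ) : ℂ) + ((0 : ℝ) : ℂ) * Complex.I := by
      push_cast
      linear_combination -(b : ℂ) ^ 2 / 2 * Complex.I_sq
    rw [hp, hq, Complex.normSq_add_mul_I, Complex.normSq_add_mul_I] at key
    have hpos : 0 < b ^ 8 + 175 / 9 * b ^ 6 + 385 / 3 * b ^ 4 + 1024 / 3 * b ^ 2 + 1540 / 9 := by
      positivity
    linarith
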